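/- Let n ≥ 2, let d ∈ ℤ₊, and let μ = f·ν be a finite complex Borel measure on S^{2n−1} which is d-pluriharmonic, i.e. π_{p,q}μ = 0 for every (p,q) ∈ ℤ₊² that does NOT satisfy ((p−d)(q−d) = 0 and p,q ≥ d). Then for every set E ⊆ S^{2n−1} with H^{2n−2}(E) = 0 one has |μ|(𝕋·E) = ∫_{𝕋·E} |f| dν = 0. -/

import Mathlib

open MeasureTheory Metric Set
open scoped ENNReal NNReal

noncomputable section

instance {n : ℕ} : MeasurableSpace (EuclideanSpace ℂ (Fin n)) := borel _
instance {n : ℕ} : BorelSpace (EuclideanSpace ℂ (Fin n)) := ⟨rfl⟩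

/-- The unit sphere `S^{2n−1} ⊆ ℂⁿ`. -/
def unitSphere (n : ℕ) : Set (EuclideanSpace ℂ (Fin n)) :=
  Metric.sphere 0 1

/-- The real Laplacian (in the `2n` real variables) of `P : ℂⁿ → ℂ` at `z`, computed
with respect to the orthonormal real basis `e_j, i·e_j`. -/
def cplxLaplacian {n : ℕ} (P : EuclideanSpace ℂ (Fin n) → ℂ)
    (z : EuclideanSpace ℂ (Fin n)) : ℂ :=
  ∑ j : Fin n,
    (fderiv ℝ (fun w => fderiv ℝ P w (EuclideanSpace.single j 1)) z
        (EuclideanSpace.single j 1) +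
      fderiv ℝ (fun w => fderiv ℝ P w (Complex.I • EuclideanSpace.single j 1)) z
        (Complex.I • EuclideanSpace.single j 1))

/-- `P : ℂⁿ → ℂ` is (the extension of) an element of `H(p,q)`: smooth, harmonic in the
`2n` real variables, and `(p,q)`-homogeneous: `P(λz) = λᵖ (conj λ)^q P(z)`. -/
def MemHpq (n p q : ℕ) (P : EuclideanSpace ℂ (Fin n) → ℂ) : Prop :=
  ContDiff ℝ (⊤ : ℕ∞) P ∧ (∀ z, cplxLaplacian P z = 0) ∧
  ∀ (c : ℂ) (z : EuclideanSpace ℂ (Fin n)),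
    P (c • z) = c ^ p * (starRingEnd ℂ c) ^ q * P z

/-- `π_{p,q}μ = 0` for the complex measure `μ = f·ν` on the sphere:
`∫ conj(h) dμ = 0` for every `h ∈ H(p,q)`. -/
def projPQZero {n : ℕ} (ν : Measure (EuclideanSpace ℂ (Fin n)))
    (f : EuclideanSpace ℂ (Fin n) → ℂ) (p q : ℕ) : Prop :=
  ∀ P : EuclideanSpace ℂ (Fin n) → ℂ, MemHpq n p q P →
    ∫ z, (starRingEnd ℂ) (P z) * f z ∂ν = 0

/-- `(p,q) ∈ κ(ε) = {(x,y) ∈ (0,∞)² : 1−ε < y/x < 1/(1−ε)}`. -/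
def memKappa (ε : ℝ) (p q : ℕ) : Prop :=
  0 < p ∧ 0 < q ∧ 1 - ε < (q : ℝ) / p ∧ (q : ℝ) / p < 1 / (1 - ε)

/-- The circle orbit `𝕋·E = {e^{it} z : z ∈ E, t ∈ ℝ}`. -/
def circleOrbit {n : ℕ} (E : Set (EuclideanSpace ℂ (Fin n))) :
    Set (EuclideanSpace ℂ (Fin n)) :=
  {w | ∃ z ∈ E, ∃ t : ℝ, w = Complex.exp (t * Complex.I) • z}


section Algebra

abbrev RR (n : ℕ) := MvPolynomial (Fin n ⊕ Fin n) ℂ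

def wl (n : ℕ) : Fin n ⊕ Fin n → ℕ := Sum.elim (fun _ => 1) (fun _ => 0)
def wr (n : ℕ) : Fin n ⊕ Fin n → ℕ := Sum.elim (fun _ => 0) (fun _ => 1)

open MvPolynomial

def BiHom {n : ℕ} (a b : ℕ) (P : RR n) : Prop :=
  IsWeightedHomogeneous (wl n) P a ∧ IsWeightedHomogeneous (wr n) P b

def Lap {n : ℕ} (P : RR n) : RR n := ∑ j, pderiv (Sum.inl j) (pderiv (Sum.inr j) P)

def rsq (n : ℕ) : RR n := ∑ j, X (Sum.inl j) * X (Sum.inr j)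

variable {n : ℕ} {a b a' b' : ℕ} {P Q : RR n}

lemma BiHom.add (hP : BiHom a b P) (hQ : BiHom a b Q) : BiHom a b (P + Q) :=
  ⟨hP.1.add hQ.1, hP.2.add hQ.2⟩
lemma BiHom.sub (hP : BiHom a b P) (hQ : BiHom a b Q) : BiHom a b (P - Q) :=
  ⟨hP.1.sub hQ.1, hP.2.sub hQ.2⟩
lemma BiHom.smul (c : ℂ) (hP : BiHom a b P) : BiHom a b (c • P) := by
  rw [MvPolynomial.smul_eq_C_mul]
  exact ⟨hP.1.C_mul c, hP.2.C_mul c⟩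
lemma BiHom.mul (hP : BiHom a b P) (hQ : BiHom a' b' Q) : BiHom (a + a') (b + b') (P * Q) :=
  ⟨hP.1.mul hQ.1, hP.2.mul hQ.2⟩
lemma BiHom.zero : BiHom a b (0 : RR n) :=
  ⟨isWeightedHomogeneous_zero _ _ _, isWeightedHomogeneous_zero _ _ _⟩
lemma BiHom.sum {ι : Type*} (s : Finset ι) (φ : ι → RR n) (h : ∀ i ∈ s, BiHom a b (φ i)) :
    BiHom a b (∑ i ∈ s, φ i) :=
  ⟨IsWeightedHomogeneous.sum _ _ _ fun i hi => (h i hi).1,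
    IsWeightedHomogeneous.sum _ _ _ fun i hi => (h i hi).2⟩
lemma BiHom.X_inl (j : Fin n) : BiHom 1 0 (X (Sum.inl j) : RR n) :=
  ⟨isWeightedHomogeneous_X _ _ _, isWeightedHomogeneous_X _ _ _⟩
lemma BiHom.X_inr (j : Fin n) : BiHom 0 1 (X (Sum.inr j) : RR n) :=
  ⟨isWeightedHomogeneous_X _ _ _, isWeightedHomogeneous_X _ _ _⟩
lemma biHom_rsq : BiHom 1 1 (rsq n) :=
  BiHom.sum _ _ fun j _ => by simpa using (BiHom.X_inl j).mul (BiHom.X_inr j)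

lemma BiHom.monomial (s : Fin n ⊕ Fin n →₀ ℕ) (c : ℂ) :
    BiHom (Finsupp.weight (wl n) s) (Finsupp.weight (wr n) s) (MvPolynomial.monomial s c) :=
  ⟨isWeightedHomogeneous_monomial _ _ _ rfl, isWeightedHomogeneous_monomial _ _ _ rfl⟩

lemma BiHom.pderiv_inl (hP : BiHom (a + 1) b P) (j : Fin n) :
    BiHom a b (pderiv (Sum.inl j) P) :=
  ⟨hP.1.pderiv rfl, hP.2.pderiv rfl⟩
lemma BiHom.pderiv_inr (hP : BiHom a (b + 1) P) (j : Fin n) :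
    BiHom a b (pderiv (Sum.inr j) P) :=
  ⟨hP.1.pderiv rfl, hP.2.pderiv rfl⟩

lemma BiHom.lap (hP : BiHom (a + 1) (b + 1) P) : BiHom a b (Lap P) :=
  BiHom.sum _ _ fun j _ => (hP.pderiv_inr j).pderiv_inl j

lemma BiHom.euler_inl (hP : BiHom a b P) :
    ∑ j, X (Sum.inl j) * pderiv (Sum.inl j) P = (a : ℂ) • P := by
  have := hP.1.sum_weight_X_mul_pderiv
  rw [Fintype.sum_sum_type] at this
  simp only [wl, Sum.elim_inl, Sum.elim_inr, one_smul, zero_smul, Finset.sum_const_zero,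
    add_zero] at this
  rw [this, Nat.cast_smul_eq_nsmul]

lemma BiHom.euler_inr (hP : BiHom a b P) :
    ∑ j, X (Sum.inr j) * pderiv (Sum.inr j) P = (b : ℂ) • P := by
  have := hP.2.sum_weight_X_mul_pderiv
  rw [Fintype.sum_sum_type] at this
  simp only [wr, Sum.elim_inl, Sum.elim_inr, one_smul, zero_smul, Finset.sum_const_zero,
    zero_add] at this
  rw [this, Nat.cast_smul_eq_nsmul]

lemma pderiv_eq_zero_of_weight {w : Fin n ⊕ Fin n → ℕ} (h : IsWeightedHomogeneous w P 0)
    (i : Fin n ⊕ Fin n) (hi : w i = 1) : pderiv i P = 0 := by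
  apply pderiv_eq_zero_of_notMem_vars
  intro hv
  obtain ⟨s, hs, hsi⟩ := (mem_vars_iff_mem_support i).1 hv
  have h0 := h (mem_support_iff.1 hs)
  rw [Finsupp.weight_apply, Finsupp.sum, Finset.sum_eq_zero_iff] at h0
  have := h0 i hsi
  simp [hi] at this
  simp [this] at hsi

lemma BiHom.lap_zero_left (hP : BiHom 0 b P) : Lap P = 0 := by
  refine Finset.sum_eq_zero fun j _ => ?_
  exact pderiv_eq_zero_of_weight (hP.1.pderiv (i := Sum.inr j) (n' := 0) rfl) (Sum.inl j) rfl

lemma BiHom.lap_zero_right (hP : BiHom a 0 P) : Lap P = 0 := by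
  refine Finset.sum_eq_zero fun j _ => ?_
  rw [pderiv_eq_zero_of_weight hP.2 (Sum.inr j) rfl, map_zero]

lemma Lap_add (P Q : RR n) : Lap (P + Q) = Lap P + Lap Q := by
  simp [Lap, Finset.sum_add_distrib]
lemma Lap_sub (P Q : RR n) : Lap (P - Q) = Lap P - Lap Q := by
  simp [Lap, Finset.sum_sub_distrib]
lemma Lap_smul (c : ℂ) (P : RR n) : Lap (c • P) = c • Lap P := by
  simp [Lap, Finset.smul_sum]

lemma pderiv_inl_rsq (j : Fin n) : pderiv (Sum.inl j) (rsq n) = X (Sum.inr j) := by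
  classical
  simp [rsq, pderiv_X, Derivation.leibniz, Pi.single_apply, Finset.sum_add_distrib]
lemma pderiv_inr_rsq (j : Fin n) : pderiv (Sum.inr j) (rsq n) = X (Sum.inl j) := by
  classical
  simp [rsq, pderiv_X, Derivation.leibniz, Pi.single_apply, Finset.sum_add_distrib]

lemma BiHom.lap_rsq_mul (hP : BiHom a b P) :
    Lap (rsq n * P) = ((n : ℂ) + a + b) • P + rsq n * Lap P := by
  have h : ∀ j : Fin n, pderiv (Sum.inl j) (pderiv (Sum.inr j) (rsq n * P)) =
      P + X (Sum.inl j) * pderiv (Sum.inl j) P + X (Sum.inr j) * pderiv (Sum.inr j) P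
      + rsq n * pderiv (Sum.inl j) (pderiv (Sum.inr j) P) := by
    intro j
    simp only [pderiv_mul, map_add, pderiv_inl_rsq, pderiv_inr_rsq, pderiv_X_self]
    ring
  simp only [Lap, h, Finset.sum_add_distrib, hP.euler_inl, hP.euler_inr, ← Finset.mul_sum]
  simp only [Finset.sum_const, Finset.card_univ, Fintype.card_fin, add_smul,
    Nat.cast_smul_eq_nsmul]

lemma solve (a : ℕ) : ∀ (b c : ℕ) (v : RR n), 0 < c → BiHom a b v →
    ∃ u, BiHom a b u ∧ (c : ℂ) • u + rsq n * Lap u = v := by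
  induction a with
  | zero =>
    intro b c v hc hv
    refine ⟨(c : ℂ)⁻¹ • v, hv.smul _, ?_⟩
    rw [(hv.smul _).lap_zero_left, smul_inv_smul₀ (by exact_mod_cast hc.ne')]; simp
  | succ a ih =>
    intro b c v hc hv
    have hc' : (c : ℂ) ≠ 0 := by exact_mod_cast hc.ne'
    cases b with
    | zero =>
      refine ⟨(c : ℂ)⁻¹ • v, hv.smul _, ?_⟩
      rw [(hv.smul _).lap_zero_right, smul_inv_smul₀ hc']; simp
    | succ b =>
      obtain ⟨w, hw, hw'⟩ := ih b (c + (n + a + b)) (Lap v) (by omega) hv.lap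
      refine ⟨(c : ℂ)⁻¹ • (v - rsq n * w), (hv.sub ?_).smul _, ?_⟩
      · simpa [add_comm] using biHom_rsq.mul hw
      have : Lap ((c : ℂ)⁻¹ • (v - rsq n * w)) = w := by
        rw [Lap_smul, Lap_sub, hw.lap_rsq_mul, ← hw', inv_smul_eq_iff₀ hc']
        push_cast
        simp only [add_smul]; abel
      rw [this, smul_inv_smul₀ hc']; simp

lemma BiHom.decomp (hn : 0 < n) (hP : BiHom (a + 1) (b + 1) P) :
    ∃ H u : RR n, BiHom (a + 1) (b + 1) H ∧ Lap H = 0 ∧ BiHom a b u ∧ P = H + rsq n * u := by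
  obtain ⟨u, hu, hu'⟩ := solve a b (n + a + b) (Lap P) (by omega) hP.lap
  refine ⟨P - rsq n * u, u, hP.sub ?_, ?_, hu, by ring⟩
  · simpa [add_comm] using biHom_rsq.mul hu
  · rw [Lap_sub, hu.lap_rsq_mul, ← hu']; push_cast; abel

end Algebra

section Analysis1
open MvPolynomial

abbrev EE (n : ℕ) := EuclideanSpace ℂ (Fin n)

variable {n : ℕ} {a b a' b' : ℕ} {P Q : RR n}

def co (i : Fin n ⊕ Fin n) : EE n →L[ℝ] ℂ :=
  Sum.elim (fun j => (EuclideanSpace.proj j : EE n →L[ℂ] ℂ).restrictScalars ℝ)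
    (fun j => (Complex.conjCLE : ℂ →L[ℝ] ℂ).comp
      ((EuclideanSpace.proj j : EE n →L[ℂ] ℂ).restrictScalars ℝ)) i

@[simp] lemma co_inl (j : Fin n) (z : EE n) : co (Sum.inl j) z = z j := rfl
@[simp] lemma co_inr (j : Fin n) (z : EE n) : co (Sum.inr j) z = (starRingEnd ℂ) (z j) := rfl

def ev (P : RR n) (z : EE n) : ℂ := eval (fun i => co i z) P

@[simp] lemma ev_add (P Q : RR n) (z : EE n) : ev (P + Q) z = ev P z + ev Q z := by simp [ev]
@[simp] lemma ev_sub (P Q : RR n) (z : EE n) : ev (P - Q) z = ev P z - ev Q z := by simp [ev]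
@[simp] lemma ev_mul (P Q : RR n) (z : EE n) : ev (P * Q) z = ev P z * ev Q z := by simp [ev]
@[simp] lemma ev_smul (c : ℂ) (P : RR n) (z : EE n) : ev (c • P) z = c * ev P z := by simp [ev]
@[simp] lemma ev_C (c : ℂ) (z : EE n) : ev (C c) z = c := by simp [ev]
@[simp] lemma ev_zero (z : EE n) : ev 0 z = 0 := by simp [ev]
@[simp] lemma ev_X (i : Fin n ⊕ Fin n) (z : EE n) : ev (X i) z = co i z := by simp [ev]
lemma ev_sum {ι : Type*} (s : Finset ι) (φ : ι → RR n) (z : EE n) :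
    ev (∑ i ∈ s, φ i) z = ∑ i ∈ s, ev (φ i) z := by simp [ev]

lemma ev_rsq (z : EE n) : ev (rsq n) z = (‖z‖ : ℂ) ^ 2 := by
  rw [rsq, ev_sum, ← Complex.ofReal_pow, EuclideanSpace.norm_sq_eq]
  simp [Complex.mul_conj, Complex.normSq_eq_norm_sq]

lemma contDiff_ev (P : RR n) : ContDiff ℝ (⊤ : ℕ∞) (ev P) := by
  induction P using MvPolynomial.induction_on with
  | C c => simpa [funext (ev_C c)] using contDiff_const
  | add p q hp hq =>
    have : ev (p + q) = fun z => ev p z + ev q z := by ext; simp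
    rw [this]; exact hp.add hq
  | mul_X p i hp =>
    have : ev (p * X i) = fun z => ev p z * co i z := by ext; simp
    rw [this]; exact hp.mul (co i).contDiff

lemma continuous_ev (P : RR n) : Continuous (ev P) := (contDiff_ev P).continuous
lemma differentiable_ev (P : RR n) : Differentiable ℝ (ev P) :=
  (contDiff_ev P).differentiable (by simp)

lemma fderiv_ev (P : RR n) (z v : EE n) :
    fderiv ℝ (ev P) z v = ∑ i, ev (pderiv i P) z * co i v := by
  classical
  induction P using MvPolynomial.induction_on with
  | C c => simp [funext (ev_C c)]
  | add p q hp hq =>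
    have : ev (p + q) = fun z => ev p z + ev q z := by ext; simp
    rw [this, fderiv_fun_add (differentiable_ev p z) (differentiable_ev q z)]
    simp [hp, hq, add_mul, Finset.sum_add_distrib]
  | mul_X p i hp =>
    have : ev (p * X i) = fun z => ev p z * co i z := by ext; simp
    rw [this, fderiv_fun_mul (differentiable_ev p z) (co i).differentiableAt]
    simp only [_root_.add_apply, _root_.smul_apply, hp, smul_eq_mul,
      pderiv_mul, pderiv_X, ev_add, ev_mul, ev_X, add_mul, Finset.sum_add_distrib,
      ContinuousLinearMap.fderiv]
    have h1 : ∑ x, ev p z * ev (Pi.single (M := fun _ => RR n) x 1 i) z * co x v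
        = ev p z * co i v := by
      rw [Finset.sum_eq_single i]
      · rw [Pi.single_eq_same]; simp [← C_1, -map_one]
      · intro b _ hb
        rw [Pi.single_eq_of_ne hb.symm]; simp
      · simp
    rw [h1, Finset.mul_sum, add_comm]
    congr 1
    exact Finset.sum_congr rfl fun x _ => by ring

lemma fderiv_ev_single (P : RR n) (j : Fin n) (z : EE n) :
    fderiv ℝ (ev P) z (EuclideanSpace.single j 1) =
      ev (pderiv (Sum.inl j) P + pderiv (Sum.inr j) P) z := by
  rw [fderiv_ev, Fintype.sum_sum_type]
  simp [PiLp.single_apply, apply_ite]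

lemma fderiv_ev_I_single (P : RR n) (j : Fin n) (z : EE n) :
    fderiv ℝ (ev P) z (Complex.I • EuclideanSpace.single j 1) =
      ev (Complex.I • (pderiv (Sum.inl j) P - pderiv (Sum.inr j) P)) z := by
  rw [fderiv_ev, Fintype.sum_sum_type]
  simp [PiLp.single_apply, apply_ite]
  ring

lemma pderiv_comm' (i j : Fin n ⊕ Fin n) (P : RR n) :
    pderiv i (pderiv j P) = pderiv j (pderiv i P) := by
  classical
  have : ⁅(pderiv i : Derivation ℂ (RR n) (RR n)), (pderiv j : Derivation ℂ (RR n) (RR n))⁆ = 0 := by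
    apply MvPolynomial.derivation_ext
    intro k
    rw [Derivation.commutator_apply, pderiv_X, pderiv_X, Derivation.zero_apply]
    have h : ∀ (i j k : Fin n ⊕ Fin n),
        pderiv i (Pi.single (M := fun _ => RR n) j 1 k) = 0 := by
      intro i j k
      by_cases h : k = j
      · subst h; simp
      · rw [Pi.single_eq_of_ne h]; simp
    rw [h, h, sub_zero]
  have h := congrArg (fun D => D P) this
  simpa [Derivation.commutator_apply, sub_eq_zero] using h

lemma cplxLaplacian_ev (P : RR n) (z : EE n) : cplxLaplacian (ev P) z = 4 * ev (Lap P) z := by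
  unfold cplxLaplacian Lap
  rw [ev_sum, Finset.mul_sum]
  refine Finset.sum_congr rfl fun j _ => ?_
  have h1 : (fun w => fderiv ℝ (ev P) w (EuclideanSpace.single j 1)) =
      ev (pderiv (Sum.inl j) P + pderiv (Sum.inr j) P) := funext (fderiv_ev_single P j)
  have h2 : (fun w => fderiv ℝ (ev P) w (Complex.I • EuclideanSpace.single j 1)) =
      ev (Complex.I • (pderiv (Sum.inl j) P - pderiv (Sum.inr j) P)) :=
        funext (fderiv_ev_I_single P j)
  have h3 : pderiv (Sum.inr j) (pderiv (Sum.inl j) P) = pderiv (Sum.inl j) (pderiv (Sum.inr j) P)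
    := pderiv_comm' _ _ _
  rw [h1, h2, fderiv_ev_single, fderiv_ev_I_single]
  simp only [map_add, map_sub, Derivation.map_smul, ev_add, ev_sub, ev_smul, h3]
  linear_combination (ev ((pderiv (Sum.inl j)) ((pderiv (Sum.inl j)) P)) z - 2 * ev (pderiv (Sum.inl j) (pderiv (Sum.inr j) P)) z +  ev ((pderiv (Sum.inr j)) ((pderiv (Sum.inr j)) P)) z) * Complex.I_sq

lemma BiHom.ev_smul_point (hP : BiHom a b P) (c : ℂ) (z : EE n) :
    ev P (c • z) = c ^ a * (starRingEnd ℂ c) ^ b * ev P z := by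
  unfold ev
  rw [eval_eq', eval_eq', Finset.mul_sum]
  refine Finset.sum_congr rfl fun s hs => ?_
  have h1 := hP.1 (mem_support_iff.1 hs)
  have h2 := hP.2 (mem_support_iff.1 hs)
  have e : ∏ i, co i (c • z) ^ s i = c ^ a * (starRingEnd ℂ c) ^ b * ∏ i, co i z ^ s i := by
    rw [Finsupp.weight_apply, Finsupp.sum_fintype _ _ (by simp), Fintype.sum_sum_type] at h1 h2
    simp [wl, wr] at h1 h2
    rw [Fintype.prod_sum_type, Fintype.prod_sum_type]
    simp [mul_pow, Finset.prod_mul_distrib, Finset.prod_pow_eq_pow_sum, h1, h2]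
    ring
  rw [e]; ring

lemma BiHom.memHpq (hP : BiHom a b P) (hL : Lap P = 0) : MemHpq n a b (ev P) :=
  ⟨contDiff_ev P, fun z => by rw [cplxLaplacian_ev, hL]; simp, hP.ev_smul_point⟩

def cj (P : RR n) : RR n := rename Sum.swap (MvPolynomial.map (starRingEnd ℂ) P)

lemma ev_cj (P : RR n) (z : EE n) : ev (cj P) z = (starRingEnd ℂ) (ev P z) := by
  induction P using MvPolynomial.induction_on with
  | C c => simp [cj]
  | add p q hp hq => 
    rw [ev_add, map_add, ← hp, ← hq]; simp [cj]
  | mul_X p i hp =>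
    rw [ev_mul, map_mul, ← hp]; rcases i with i | i <;> simp [cj]

lemma cj_monomial (s : Fin n ⊕ Fin n →₀ ℕ) (c : ℂ) :
    cj (monomial s c) = monomial (s.mapDomain Sum.swap) ((starRingEnd ℂ) c) := by
  simp [cj, rename_monomial]

lemma cj_add (P Q : RR n) : cj (P + Q) = cj P + cj Q := by simp [cj]
lemma cj_mul (P Q : RR n) : cj (P * Q) = cj P * cj Q := by simp [cj]
lemma cj_sum {ι : Type*} (s : Finset ι) (φ : ι → RR n) :
    cj (∑ i ∈ s, φ i) = ∑ i ∈ s, cj (φ i) := by simp [cj]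

lemma BiHom.cj (hP : BiHom a b P) : BiHom b a (cj P) := by
  rw [P.as_sum, cj_sum]
  refine BiHom.sum _ _ fun s hs => ?_
  rw [cj_monomial]
  have h1 := hP.1 (mem_support_iff.1 hs)
  have h2 := hP.2 (mem_support_iff.1 hs)
  constructor
  · apply isWeightedHomogeneous_monomial
    rw [← h2, Finsupp.weight_apply, Finsupp.weight_apply, Finsupp.sum_mapDomain_index (by simp)
      (by intros; simp [add_mul])]
    refine Finsupp.sum_congr fun i _ => ?_
    rcases i with i | i <;> simp [wl, wr]
  · apply isWeightedHomogeneous_monomial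
    rw [← h1, Finsupp.weight_apply, Finsupp.weight_apply, Finsupp.sum_mapDomain_index (by simp)
      (by intros; simp [add_mul])]
    refine Finsupp.sum_congr fun i _ => ?_
    rcases i with i | i <;> simp [wl, wr]

lemma pderiv_cj (i : Fin n ⊕ Fin n) (P : RR n) :
    pderiv i (cj P) = cj (pderiv i.swap P) := by
  classical
  induction P using MvPolynomial.induction_on with
  | C c => simp [cj]
  | add p q hp hq => simp [cj_add, hp, hq]
  | mul_X p k hp =>
    have hX : cj (X k : RR n) = X k.swap := by simp [cj]
    have h1 : pderiv i (X k.swap : RR n) = cj (pderiv i.swap (X k : RR n)) := by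
      by_cases h : k = i.swap
      · subst h; simp [cj]
      · rw [pderiv_X_of_ne h, pderiv_X_of_ne (by
          intro h'; apply h; rw [← h', Sum.swap_swap])]
        simp [cj]
    rw [cj_mul, pderiv_mul, pderiv_mul, cj_add, cj_mul, cj_mul, hp, hX, h1]

lemma Lap_cj (P : RR n) : Lap (cj P) = cj (Lap P) := by
  simp only [Lap, cj_sum, pderiv_cj, Sum.swap_inl, Sum.swap_inr]
  exact Finset.sum_congr rfl fun j _ => by rw [pderiv_comm']
end Analysis1

section Gaussian
open MvPolynomial

variable {n : ℕ} {a b a' b' : ℕ} {P Q : RR n}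

def lam (n : ℕ) : Measure (EE n) := Measure.addHaar

instance : (lam n).IsAddHaarMeasure := by unfold lam; infer_instance

def gau (z : EE n) : ℂ := Complex.exp (-(ev (rsq n) z))

lemma gau_eq (z : EE n) : gau z = (Real.exp (-‖z‖ ^ 2) : ℝ) := by
  rw [gau, ev_rsq]; push_cast; rfl

lemma differentiable_gau : Differentiable ℝ (gau (n := n)) := by
  unfold gau
  exact (differentiable_ev _).neg.cexp

lemma continuous_gau : Continuous (gau (n := n)) := differentiable_gau.continuous

lemma fderiv_gau (z v : EE n) : fderiv ℝ gau z v = - (gau z * fderiv ℝ (ev (rsq n)) z v) := by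
  have h := ((differentiable_ev (rsq n) z).hasFDerivAt.neg).cexp
  have : fderiv ℝ gau z = _ := h.fderiv
  rw [this]
  simp [gau]

lemma norm_co_le (i : Fin n ⊕ Fin n) (z : EE n) : ‖co i z‖ ≤ ‖z‖ := by
  rcases i with i | i
  · exact PiLp.norm_apply_le z i
  · simpa using PiLp.norm_apply_le z i

lemma ev_growth (P : RR n) : ∃ (K : ℝ) (N : ℕ), 0 ≤ K ∧ ∀ z : EE n, ‖ev P z‖ ≤ K * (1 + ‖z‖) ^ N := by
  induction P using MvPolynomial.induction_on with
  | C c => exact ⟨‖c‖, 0, by positivity, fun z => by simp⟩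
  | add p q hp hq =>
    obtain ⟨K, N, hK, h⟩ := hp
    obtain ⟨K', N', hK', h'⟩ := hq
    refine ⟨K + K', N + N', by positivity, fun z => ?_⟩
    have hz : 1 ≤ 1 + ‖z‖ := by linarith [norm_nonneg z]
    rw [ev_add, add_mul]
    refine (norm_add_le _ _).trans (add_le_add ((h z).trans ?_) ((h' z).trans ?_))
    · gcongr; omega
    · gcongr; omega
  | mul_X p i hp =>
    obtain ⟨K, N, hK, h⟩ := hp
    refine ⟨K, N + 1, hK, fun z => ?_⟩
    rw [ev_mul, ev_X, norm_mul, pow_succ, ← mul_assoc]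
    have := norm_co_le i z
    gcongr
    exacts [h z, by linarith]

lemma gau_bound (t : ℝ) (ht : 0 ≤ t) (N : ℕ) :
    (1 + t) ^ N * Real.exp (-t ^ 2) ≤ N.factorial * Real.exp 2 := by
  have h1 := Real.pow_div_factorial_le_exp (x := 1 + t) (by linarith) N
  rw [div_le_iff₀ (by positivity)] at h1
  calc (1 + t) ^ N * Real.exp (-t ^ 2) ≤ (Real.exp (1 + t) * N.factorial) * Real.exp (1 - t) := by
        gcongr
        nlinarith [sq_nonneg (t - 1)]
    _ = N.factorial * Real.exp 2 := by
        rw [mul_right_comm, ← Real.exp_add, mul_comm]; congr 2; ring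

lemma integrable_ev_gau (P : RR n) : Integrable (fun z => ev P z * gau z) (lam n) := by
  obtain ⟨K, N, hK, h⟩ := ev_growth P
  have hi := integrable_one_add_norm (E := EE n) (μ := lam n)
    (r := (Module.finrank ℝ (EE n) + 1 : ℕ)) (by push_cast; linarith)
  refine (hi.const_mul (K * ((N + (Module.finrank ℝ (EE n) + 1)).factorial * Real.exp 2))).mono'
    ((continuous_ev P).mul continuous_gau).aestronglyMeasurable (.of_forall fun z => ?_)
  rw [norm_mul, gau_eq, Complex.norm_real, Real.norm_of_nonneg (by positivity),
    Real.rpow_neg (by positivity), Real.rpow_natCast, ← div_eq_mul_inv,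
    le_div_iff₀ (by positivity)]
  have := gau_bound ‖z‖ (norm_nonneg z) (N + (Module.finrank ℝ (EE n) + 1))
  calc _ ≤ K * (1 + ‖z‖) ^ N * Real.exp (-‖z‖ ^ 2) * (1 + ‖z‖) ^ (Module.finrank ℝ (EE n) + 1) := by
        gcongr; exact h z
    _ = K * ((1 + ‖z‖) ^ (N + (Module.finrank ℝ (EE n) + 1)) * Real.exp (-‖z‖ ^ 2)) := by
        rw [pow_add]; ring
    _ ≤ _ := by gcongr

def Lam (P : RR n) : ℂ := ∫ z, ev P z * gau z ∂(lam n)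

lemma Lam_add (P Q : RR n) : Lam (P + Q) = Lam P + Lam Q := by
  simp only [Lam, ev_add, add_mul]
  exact integral_add (integrable_ev_gau P) (integrable_ev_gau Q)
lemma Lam_smul (c : ℂ) (P : RR n) : Lam (c • P) = c * Lam P := by
  simp only [Lam, ev_smul, mul_assoc]
  exact integral_const_mul _ _
lemma Lam_sub (P Q : RR n) : Lam (P - Q) = Lam P - Lam Q := by
  rw [sub_eq_add_neg, Lam_add, ← neg_one_smul ℂ Q, Lam_smul]; ring
lemma Lam_zero : Lam (0 : RR n) = 0 := by simp [Lam]
lemma Lam_sum {ι : Type*} (s : Finset ι) (φ : ι → RR n) :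
    Lam (∑ i ∈ s, φ i) = ∑ i ∈ s, Lam (φ i) := by
  classical
  induction s using Finset.induction_on with
  | empty => simp [Lam_zero]
  | insert i s hi ih => rw [Finset.sum_insert hi, Finset.sum_insert hi, Lam_add, ih]

lemma Lam_ibp (P D G : RR n) (v : EE n) (hD : ∀ z, fderiv ℝ (ev P) z v = ev D z)
    (hG : ∀ z, fderiv ℝ (ev (rsq n)) z v = ev G z) : Lam D = Lam (P * G) := by
  have e1 : (fun z => fderiv ℝ (ev P) z v * gau z) = fun z => ev D z * gau z := by
    ext z; rw [hD]
  have e2 : (fun z => ev P z * fderiv ℝ gau z v) = fun z => -(ev (P * G) z * gau z) := by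
    ext z; rw [fderiv_gau, hG, ev_mul]; ring
  have h := integral_mul_fderiv_eq_neg_fderiv_mul_of_integrable (μ := lam n) (f := ev P)
    (g := gau) (v := v) (by rw [e1]; exact integrable_ev_gau D)
    (by rw [e2]; exact (integrable_ev_gau _).neg) (integrable_ev_gau P)
    (fun x _ => differentiable_ev P x) (fun x _ => differentiable_gau x)
  rw [e1, e2, integral_neg, neg_inj] at h
  exact h.symm

lemma Lam_ibp_both (P : RR n) (j : Fin n) :
    Lam (pderiv (Sum.inl j) P) = Lam (P * X (Sum.inr j)) ∧
    Lam (pderiv (Sum.inr j) P) = Lam (P * X (Sum.inl j)) := by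
  have h1 := Lam_ibp P _ _ _ (fderiv_ev_single P j) (fderiv_ev_single _ j)
  have h2 := Lam_ibp P _ _ _ (fderiv_ev_I_single P j) (fderiv_ev_I_single _ j)
  rw [pderiv_inl_rsq, pderiv_inr_rsq] at h1 h2
  rw [mul_smul_comm, Lam_smul, Lam_smul, mul_sub, Lam_sub, Lam_sub] at h2
  have h2 := mul_left_cancel₀ Complex.I_ne_zero h2
  rw [mul_add, Lam_add, Lam_add] at h1
  constructor
  · linear_combination (h1 + h2) / 2
  · linear_combination (h1 - h2) / 2

lemma Lam_orth (hP : BiHom a b P) (hQ : BiHom a' b' Q) (hLP : Lap P = 0) (hLQ : Lap Q = 0)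
    (hab : a ≠ b') : Lam (P * Q) = 0 := by
  have h1 : ∑ j, Lam (pderiv (Sum.inl j) P * pderiv (Sum.inr j) Q) = b' * Lam (P * Q) := by
    have : ∀ j, Lam (pderiv (Sum.inl j) P * pderiv (Sum.inr j) Q) =
        Lam (P * (X (Sum.inr j) * pderiv (Sum.inr j) Q)) -
          Lam (P * pderiv (Sum.inl j) (pderiv (Sum.inr j) Q)) := by
      intro j
      have := (Lam_ibp_both (P * pderiv (Sum.inr j) Q) j).1
      rw [pderiv_mul, Lam_add] at this
      rw [show P * (X (Sum.inr j) * pderiv (Sum.inr j) Q) =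
        P * pderiv (Sum.inr j) Q * X (Sum.inr j) by ring, ← this]
      ring
    simp only [this, Finset.sum_sub_distrib, ← Lam_sum, ← Finset.mul_sum, hQ.euler_inr]
    rw [← Lap, hLQ, mul_zero, Lam_zero, mul_smul_comm, Lam_smul, sub_zero]
  have h2 : ∑ j, Lam (pderiv (Sum.inl j) P * pderiv (Sum.inr j) Q) = a * Lam (P * Q) := by
    have : ∀ j, Lam (pderiv (Sum.inl j) P * pderiv (Sum.inr j) Q) =
        Lam ((X (Sum.inl j) * pderiv (Sum.inl j) P) * Q) -
          Lam (pderiv (Sum.inl j) (pderiv (Sum.inr j) P) * Q) := by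
      intro j
      have := (Lam_ibp_both (pderiv (Sum.inl j) P * Q) j).2
      rw [pderiv_mul, Lam_add, pderiv_comm'] at this
      rw [show (X (Sum.inl j) * pderiv (Sum.inl j) P) * Q =
        pderiv (Sum.inl j) P * Q * X (Sum.inl j) by ring, ← this]
      ring
    simp only [this, Finset.sum_sub_distrib, ← Lam_sum, ← Finset.sum_mul, hP.euler_inl]
    rw [← Lap, hLP, zero_mul, Lam_zero, smul_mul_assoc, Lam_smul, sub_zero]
  rw [h1] at h2
  have h3 : ((a : ℂ) - b') * Lam (P * Q) = 0 := by linear_combination -h2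
  rcases mul_eq_zero.1 h3 with h | h
  · exact absurd (by exact_mod_cast sub_eq_zero.1 h) hab
  · exact h

def sig (n : ℕ) : Measure (sphere (0 : EE n) 1) := (lam n).toSphere

instance : IsFiniteMeasure (sig n) := by unfold sig; infer_instance

lemma polar (hn : 0 < n) (G : EE n → ℂ) (g : sphere (0 : EE n) 1 → ℂ) (k : ℝ → ℂ)
    (h : ∀ (s : sphere (0 : EE n) 1) (r : ℝ), 0 < r → G (r • (s : EE n)) = g s * k r) :
    ∫ z, G z ∂(lam n) = (∫ s, g s ∂(sig n)) *
      ∫ r, k (r : Ioi (0 : ℝ)) ∂(Measure.volumeIoiPow (Module.finrank ℝ (EE n) - 1)) := by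
  have : Nonempty (Fin n) := ⟨⟨0, hn⟩⟩
  have : Nontrivial (EE n) := inferInstance
  rw [← integral_prod_mul (μ := sig n)
    (ν := Measure.volumeIoiPow (Module.finrank ℝ (EE n) - 1)) g (fun r => k r), sig,
    ← ((lam n).measurePreserving_homeomorphUnitSphereProd).map_eq,
    (homeomorphUnitSphereProd (EE n)).measurableEmbedding.integral_map]
  have e : ∀ x : ({0}ᶜ : Set (EE n)), g (homeomorphUnitSphereProd (EE n) x).1 *
      k ((homeomorphUnitSphereProd (EE n) x).2 : ℝ) = G x := by
    intro x
    rw [← h _ _ (homeomorphUnitSphereProd (EE n) x).2.2]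
    congr 1
    have hx : ‖(x : EE n)‖ ≠ 0 := norm_ne_zero_iff.2 x.2
    simp [smul_smul, hx]
  simp only [e]
  rw [integral_subtype_comap (measurableSet_singleton _).compl, restrict_compl_singleton]

end Gaussian

section Riesz
open MvPolynomial

variable {n : ℕ} {a b a' b' : ℕ} {P Q : RR n}

def radc (n m : ℕ) : ℂ := ∫ r : Ioi (0 : ℝ), ((r : ℝ) : ℂ) ^ m * (Real.exp (-(r : ℝ) ^ 2) : ℝ)
  ∂(Measure.volumeIoiPow (Module.finrank ℝ (EE n) - 1))

lemma radc_ne_zero (hn : 0 < n) (m : ℕ) : radc n m ≠ 0 := by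
  have : Nonempty (Fin n) := ⟨⟨0, hn⟩⟩
  have : Nontrivial (EE n) := inferInstance
  have h := polar hn (fun z => ((‖z‖ ^ m * Real.exp (-‖z‖ ^ 2) : ℝ) : ℂ)) (fun _ => 1)
    (fun r => (r : ℂ) ^ m * (Real.exp (-r ^ 2) : ℝ)) (by
      intro s r hr
      have hs : ‖(s : EE n)‖ = 1 := by simp
      simp only [norm_smul, hs, mul_one, Real.norm_of_nonneg hr.le, one_mul]
      push_cast; rfl)
  intro h0
  rw [radc] at h0
  rw [h0, mul_zero, integral_complex_ofReal, Complex.ofReal_eq_zero] at h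
  have hint : Integrable (fun z : EE n => ‖z‖ ^ m * Real.exp (-‖z‖ ^ 2)) (lam n) := by
    refine (integrable_ev_gau ((1 + rsq n) ^ m)).norm.mono' (by fun_prop) (.of_forall fun z => ?_)
    have : ev ((1 + rsq n) ^ m) z = (((1 + ‖z‖ ^ 2) ^ m : ℝ) : ℂ) := by
      have := ev_rsq z
      unfold ev at this ⊢
      simp [this]
    rw [gau_eq, this, norm_mul, norm_mul, Complex.norm_real, Complex.norm_real]
    gcongr ?_ * _
    rw [Real.norm_of_nonneg (by positivity), Real.norm_of_nonneg (by positivity)]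
    gcongr
    nlinarith [sq_nonneg (‖z‖ - 1)]
  have hpos : 0 < ∫ z : EE n, ‖z‖ ^ m * Real.exp (-‖z‖ ^ 2) ∂(lam n) := by
    rw [integral_pos_iff_support_of_nonneg (fun z => by positivity) hint]
    refine lt_of_lt_of_le ?_ (measure_mono (s := {0}ᶜ) ?_)
    · exact isOpen_compl_singleton.measure_pos _ (exists_ne 0)
    · intro z hz
      have : ‖z‖ ≠ 0 := norm_ne_zero_iff.2 hz
      simp [this]
  exact hpos.ne' h

lemma BiHom.Lam_eq (hn : 0 < n) (hP : BiHom a b P) :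
    Lam P = (∫ s : sphere (0 : EE n) 1, ev P s ∂(sig n)) * radc n (a + b) := by
  refine polar hn (fun z => ev P z * gau z) (fun s => ev P s)
    (fun r => (r : ℂ) ^ (a + b) * (Real.exp (-r ^ 2) : ℝ)) ?_
  intro s r hr
  have hs : ‖(s : EE n)‖ = 1 := by simp
  have e : r • (s : EE n) = (r : ℂ) • (s : EE n) := by simp
  rw [gau_eq, norm_smul, hs, mul_one, Real.norm_of_nonneg hr.le, e, hP.ev_smul_point,
    Complex.conj_ofReal, pow_add]
  ring

lemma sig_orth (hn : 0 < n) (hP : BiHom a b P) (hQ : BiHom a' b' Q) (hLP : Lap P = 0)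
    (hLQ : Lap Q = 0) (hab : a ≠ b') : ∫ s : sphere (0 : EE n) 1, ev P s * ev Q s ∂(sig n) = 0 := by
  have h1 := Lam_orth hP hQ hLP hLQ hab
  rw [(hP.mul hQ).Lam_eq hn] at h1
  simpa [radc_ne_zero hn] using h1

lemma sig_pos (hn : 0 < n) (hP : BiHom a b P)
    (h : ∫ s : sphere (0 : EE n) 1, (starRingEnd ℂ) (ev P s) * ev P s ∂(sig n) = 0) :
    ev P = 0 := by
  have h1 : Lam (cj P * P) = 0 := by
    rw [(hP.cj.mul hP).Lam_eq hn]
    simp only [ev_mul, ev_cj]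
    rw [h, zero_mul]
  have e : ∀ z, ev (cj P * P) z * gau z = ((‖ev P z‖ ^ 2 * Real.exp (-‖z‖ ^ 2) : ℝ) : ℂ) := by
    intro z
    rw [ev_mul, ev_cj, gau_eq, Complex.conj_mul']; push_cast; rfl
  have hi := integrable_ev_gau (cj P * P)
  simp only [Lam, e] at h1 hi
  rw [integral_complex_ofReal, Complex.ofReal_eq_zero] at h1
  have hi' : Integrable (fun z => ‖ev P z‖ ^ 2 * Real.exp (-‖z‖ ^ 2)) (lam n) := by
    exact hi.re
  rw [integral_eq_zero_iff_of_nonneg (fun z => by positivity) hi'] at h1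
  have hc : Continuous (fun z => ‖ev P z‖ ^ 2 * Real.exp (-‖z‖ ^ 2)) := by
    have := continuous_ev P
    fun_prop
  have h2 := Continuous.ae_eq_iff_eq (lam n) hc continuous_zero |>.1 h1
  ext z
  have := congrFun h2 z
  simpa using this

def VV (n a b : ℕ) : Submodule ℂ (RR n) where
  carrier := {P | BiHom a b P ∧ Lap P = 0}
  add_mem' := fun {P Q} hP hQ => ⟨hP.1.add hQ.1, by rw [Lap_add, hP.2, hQ.2, add_zero]⟩
  zero_mem' := ⟨BiHom.zero, by simp [Lap]⟩
  smul_mem' := fun c P hP => ⟨hP.1.smul c, by rw [Lap_smul, hP.2, smul_zero]⟩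

instance : FiniteDimensional ℂ (VV n a b) := by
  have h1 : (homogeneousSubmodule (Fin n ⊕ Fin n) ℂ (a + b)).FG :=
    weightedHomogeneousSubmodule_fg (R := ℂ) (1 : Fin n ⊕ Fin n → ℕ) (by simp) (a + b)
  have h1 := Module.Finite.iff_fg.2 h1
  refine Submodule.finiteDimensional_of_le (S₂ := homogeneousSubmodule (Fin n ⊕ Fin n) ℂ (a + b)) ?_
  intro P hP s hs
  have h1 := hP.1.1 hs
  have h2 := hP.1.2 hs
  rw [Finsupp.weight_apply, Finsupp.sum_fintype _ _ (by simp), Fintype.sum_sum_type] at h1 h2 ⊢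
  simp [wl, wr] at h1 h2 ⊢
  rw [h1, h2]

def evl (n : ℕ) : RR n →ₗ[ℂ] (EE n → ℂ) where
  toFun := ev
  map_add' P Q := by ext; simp
  map_smul' c P := by ext; simp

def WW (n a b : ℕ) : Submodule ℂ (EE n → ℂ) := (VV n a b).map (evl n)

instance : FiniteDimensional ℂ (WW n a b) := by unfold WW; infer_instance

lemma WW_cont (φ : WW n a b) : Continuous (φ : EE n → ℂ) := by
  obtain ⟨_, P, hP, rfl⟩ := φ
  exact continuous_ev P

lemma sig_integrable {φ : EE n → ℂ} (h : Continuous φ) :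
    Integrable (fun s : sphere (0 : EE n) 1 => φ s) (sig n) :=
  (h.comp continuous_subtype_val).integrable_of_hasCompactSupport (.of_compactSpace _)

def Phi (n a b : ℕ) : WW n a b →ₗ[ℝ] Module.Dual ℂ (WW n a b) where
  toFun φ :=
    { toFun := fun ψ => ∫ s : sphere (0 : EE n) 1, (starRingEnd ℂ) ((φ : EE n → ℂ) s) *
        (ψ : EE n → ℂ) s ∂(sig n)
      map_add' := fun ψ ψ' => by
        simp only [Submodule.coe_add, Pi.add_apply, mul_add]
        have h1 := WW_cont φ
        have h2 := WW_cont ψ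
        have h3 := WW_cont ψ'
        exact integral_add (sig_integrable (φ := fun z => (starRingEnd ℂ) ((φ : EE n → ℂ) z) *
          (ψ : EE n → ℂ) z) (by fun_prop)) (sig_integrable (φ := fun z => (starRingEnd ℂ)
            ((φ : EE n → ℂ) z) * (ψ' : EE n → ℂ) z) (by fun_prop))
      map_smul' := fun c ψ => by
        simp only [Submodule.coe_smul, Pi.smul_apply, smul_eq_mul, RingHom.id_apply]
        rw [← integral_const_mul]
        congr 1; ext s; ring }
  map_add' φ φ' := by
    ext ψ
    simp only [Submodule.coe_add, Pi.add_apply, map_add, add_mul, LinearMap.coe_mk, AddHom.coe_mk,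
      LinearMap.add_apply]
    have h1 := WW_cont φ
    have h2 := WW_cont ψ
    have h3 := WW_cont φ'
    exact integral_add (sig_integrable (φ := fun z => (starRingEnd ℂ) ((φ : EE n → ℂ) z) *
          (ψ : EE n → ℂ) z) (by fun_prop)) (sig_integrable (φ := fun z => (starRingEnd ℂ)
            ((φ' : EE n → ℂ) z) * (ψ : EE n → ℂ) z) (by fun_prop))
  map_smul' c φ := by
    ext ψ
    simp only [LinearMap.coe_mk, AddHom.coe_mk, RingHom.id_apply, LinearMap.smul_apply]
    rw [Complex.real_smul, ← integral_const_mul]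
    congr 1; ext s
    simp; ring

lemma Phi_surj (hn : 0 < n) : Function.Surjective (Phi n a b) := by
  have hinj : Function.Injective (Phi n a b) := by
    rw [injective_iff_map_eq_zero]
    rintro ⟨_, P, hP, rfl⟩ h
    have := congrArg (fun l => l ⟨_, P, hP, rfl⟩) h
    have h2 := sig_pos hn hP.1 this
    exact Subtype.ext h2
  refine (LinearMap.injective_iff_surjective_of_finrank_eq_finrank ?_).1 hinj
  rw [finrank_real_of_complex, finrank_real_of_complex, Subspace.dual_finrank_eq]

lemma riesz (hn : 0 < n) (a b : ℕ) (L : WW n a b →ₗ[ℂ] ℂ) :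
    ∃ h : RR n, BiHom b a h ∧ Lap h = 0 ∧ ∀ P (hP : P ∈ VV n a b),
      L ⟨ev P, P, hP, rfl⟩ = ∫ s : sphere (0 : EE n) 1, ev P s * ev h s ∂(sig n) := by
  obtain ⟨⟨_, g, hg, rfl⟩, hL⟩ := Phi_surj hn L
  refine ⟨cj g, hg.1.cj, by rw [Lap_cj, hg.2]; simp [cj], fun P hP => ?_⟩
  rw [← hL]
  simp only [ev_cj, mul_comm (ev P _)]
  rfl

end Riesz

section Key
open MvPolynomial

variable {n : ℕ} {a b a' b' : ℕ} {P Q : RR n}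

lemma ae_sphere {ν : Measure (EE n)} (hsupp : ν (unitSphere n)ᶜ = 0) : ∀ᵐ z ∂ν, ‖z‖ = 1 := by
  have : ∀ᵐ z ∂ν, z ∈ unitSphere n := by rw [ae_iff]; exact hsupp
  filter_upwards [this] with z hz
  simpa [unitSphere] using hz

lemma integrable_ev_mul {ν : Measure (EE n)} (hsupp : ν (unitSphere n)ᶜ = 0) {f : EE n → ℂ}
    (hf : Integrable f ν) (P : RR n) : Integrable (fun z => ev P z * f z) ν := by
  obtain ⟨K, N, hK, h⟩ := ev_growth P
  refine hf.bdd_mul (c := K * 2 ^ N) (continuous_ev P).aestronglyMeasurable ?_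
  filter_upwards [ae_sphere hsupp] with z hz
  refine (h z).trans ?_
  rw [hz]; norm_num

lemma key (hn : 0 < n) (d : ℕ) (ν : Measure (EE n)) (hsupp : ν (unitSphere n)ᶜ = 0)
    (f : EE n → ℂ) (hf : Integrable f ν)
    (hdpluri : ∀ p q : ℕ,
      ¬ (((p : ℤ) - d) * ((q : ℤ) - d) = 0 ∧ d ≤ p ∧ d ≤ q) →
      projPQZero ν f p q) (a b : ℕ) :
    ∃ h : RR n, ∀ (a' b' : ℕ) (P : RR n), BiHom a' b' P → a' + b = b' + a →
      ∫ z, ev P z * f z ∂ν = ∫ s : sphere (0 : EE n) 1, ev P s * ev h s ∂(sig n) := by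
  have hiW : ∀ φ : WW n (d + (a - b)) (d + (b - a)),
      Integrable (fun z => (φ : EE n → ℂ) z * f z) ν := by
    rintro ⟨_, P, hP, rfl⟩
    exact integrable_ev_mul hsupp hf P
  let L : WW n (d + (a - b)) (d + (b - a)) →ₗ[ℂ] ℂ :=
    { toFun := fun φ => ∫ z, (φ : EE n → ℂ) z * f z ∂ν
      map_add' := fun φ ψ => by
        simp only [Submodule.coe_add, Pi.add_apply, add_mul]
        exact integral_add (hiW φ) (hiW ψ)
      map_smul' := fun c φ => by
        simp only [Submodule.coe_smul, Pi.smul_apply, smul_eq_mul, RingHom.id_apply, mul_assoc]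
        exact integral_const_mul _ _ }
  obtain ⟨h, hh, hLh, hr⟩ := riesz hn _ _ L
  have harm : ∀ (a' b' : ℕ) (P : RR n), BiHom a' b' P → Lap P = 0 → a' + b = b' + a →
      ∫ z, ev P z * f z ∂ν = ∫ s : sphere (0 : EE n) 1, ev P s * ev h s ∂(sig n) := by
    intro a' b' P hP hLP hab
    by_cases h0 : a' = d + (a - b)
    · have h1 : b' = d + (b - a) := by omega
      subst h0 h1
      exact hr P ⟨hP, hLP⟩
    · rw [sig_orth hn hP hh hLP hLh h0]
      have := hdpluri b' a' (by
        rintro ⟨h1, h2, h3⟩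
        rcases mul_eq_zero.1 h1 with h1 | h1 <;> omega) (ev (cj P))
          (hP.cj.memHpq (by rw [Lap_cj, hLP]; simp [cj]))
      simpa [ev_cj] using this
  refine ⟨h, ?_⟩
  intro a'
  induction a' with
  | zero => exact fun b' P hP => harm 0 b' P hP hP.lap_zero_left
  | succ a' ih =>
    intro b' P hP hab
    cases b' with
    | zero => exact harm _ 0 P hP hP.lap_zero_right hab
    | succ b' =>
      obtain ⟨H, u, hH, hLH, hu, rfl⟩ := hP.decomp hn
      have e1 : ∫ z, ev (H + rsq n * u) z * f z ∂ν
          = ∫ z, ev H z * f z ∂ν + ∫ z, ev u z * f z ∂ν := by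
        rw [← integral_add (integrable_ev_mul hsupp hf H) (integrable_ev_mul hsupp hf u)]
        refine integral_congr_ae ?_
        filter_upwards [ae_sphere hsupp] with z hz
        rw [ev_add, ev_mul, ev_rsq, hz]; simp; ring
      have e2 : ∫ s : sphere (0 : EE n) 1, ev (H + rsq n * u) s * ev h s ∂(sig n)
          = ∫ s : sphere (0 : EE n) 1, ev H s * ev h s ∂(sig n)
            + ∫ s : sphere (0 : EE n) 1, ev u s * ev h s ∂(sig n) := by
        have := continuous_ev h
        rw [← integral_add (sig_integrable (φ := fun z => ev H z * ev h z) ((continuous_ev H).mul (continuous_ev h)))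
          (sig_integrable (φ := fun z => ev u z * ev h z) ((continuous_ev u).mul (continuous_ev h)))]
        congr 1; ext s
        have hs : ‖(s : EE n)‖ = 1 := by simp
        rw [ev_add, ev_mul, ev_rsq, hs]; simp; ring
      rw [e1, e2, harm _ _ H hH hLH hab, ih b' u hu (by omega)]

end Key

section Det
open MvPolynomial Filter Topology

variable {ι : Type} [Fintype ι]

def evp (p : MvPolynomial (ι ⊕ ι) ℂ) (x : ι → ℂ) : ℂ :=
  eval (Sum.elim x (fun i => (starRingEnd ℂ) (x i))) p

lemma continuous_evp (p : MvPolynomial (ι ⊕ ι) ℂ) : Continuous (evp p) := by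
  unfold evp
  refine (MvPolynomial.continuous_eval p).comp (continuous_pi fun i => ?_)
  rcases i with i | i
  · exact continuous_apply i
  · exact Complex.continuous_conj.comp (continuous_apply i)

lemma evp_conj (p : MvPolynomial (ι ⊕ ι) ℂ) (x : ι → ℂ) :
    evp (rename Sum.swap (MvPolynomial.map (starRingEnd ℂ) p)) x = (starRingEnd ℂ) (evp p x) := by
  induction p using MvPolynomial.induction_on with
  | C c => simp [evp]
  | add p q hp hq =>
    simp only [evp, map_add] at *
    rw [hp, hq]
  | mul_X p i hp =>
    simp only [evp, map_mul] at *
    rw [hp]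
    rcases i with i | i <;> simp

def polyAlg (K : Set (ι → ℂ)) [CompactSpace K] : StarSubalgebra ℂ C(K, ℂ) where
  carrier := {φ | ∃ p : MvPolynomial (ι ⊕ ι) ℂ, ∀ x : K, φ x = evp p x}
  mul_mem' := by
    rintro φ ψ ⟨p, hp⟩ ⟨q, hq⟩
    exact ⟨p * q, fun x => by simp [hp, hq, evp]⟩
  add_mem' := by
    rintro φ ψ ⟨p, hp⟩ ⟨q, hq⟩
    exact ⟨p + q, fun x => by simp [hp, hq, evp]⟩
  algebraMap_mem' c := ⟨C c, fun x => by simp [evp]⟩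
  star_mem' := by
    rintro φ ⟨p, hp⟩
    exact ⟨_, fun x => by rw [evp_conj, ← hp]; rfl⟩

lemma approx (K : Set (ι → ℂ)) [CompactSpace K] (φ : (ι → ℂ) → ℂ) (hφ : Continuous φ)
    (ε : ℝ) (hε : 0 < ε) : ∃ p : MvPolynomial (ι ⊕ ι) ℂ, ∀ x ∈ K, ‖φ x - evp p x‖ ≤ ε := by
  have h := ContinuousMap.starSubalgebra_topologicalClosure_eq_top_of_separatesPoints
    (polyAlg K) (by
      rintro ⟨x, hx⟩ ⟨y, hy⟩ hxy
      have : ∃ i, x i ≠ y i := by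
        by_contra hcon
        push Not at hcon
        exact hxy (Subtype.ext (funext hcon))
      obtain ⟨i, hi⟩ := this
      refine ⟨fun z => (z : ι → ℂ) i, ⟨⟨fun z => (z : ι → ℂ) i, (continuous_apply i).comp continuous_subtype_val⟩,
        ⟨X (Sum.inl i), fun x => by simp [evp]⟩, rfl⟩, hi⟩)
  let Φ : C(K, ℂ) := ⟨fun x => φ x, hφ.comp continuous_subtype_val⟩
  have hΦ : Φ ∈ (polyAlg K).topologicalClosure := by rw [h]; trivial
  rw [← SetLike.mem_coe, StarSubalgebra.topologicalClosure_coe, Metric.mem_closure_iff] at hΦ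
  obtain ⟨ψ, ⟨p, hp⟩, hd⟩ := hΦ ε hε
  refine ⟨p, fun x hx => ?_⟩
  have := (ContinuousMap.dist_apply_le_dist (f := Φ) (g := ψ) ⟨x, hx⟩).trans hd.le
  rwa [dist_eq_norm, hp ⟨x, hx⟩] at this

variable {γ : Type*} [MeasurableSpace γ]

lemma det_cont (m : Measure γ) (T : γ → ι → ℂ) (hT : Measurable T) (w : γ → ℂ)
    (hw : Integrable w m) (R : ℝ) (hR : ∀ᵐ x ∂m, ‖T x‖ ≤ R)
    (h : ∀ p : MvPolynomial (ι ⊕ ι) ℂ, ∫ x, evp p (T x) * w x ∂m = 0)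
    (φ : (ι → ℂ) → ℂ) (hφ : Continuous φ) : ∫ x, φ (T x) * w x ∂m = 0 := by
  have hcK : IsCompact (closedBall (0 : ι → ℂ) R) := isCompact_closedBall _ _
  have : CompactSpace (closedBall (0 : ι → ℂ) R) := isCompact_iff_compactSpace.1 hcK
  have hint : ∀ φ : (ι → ℂ) → ℂ, Continuous φ → Integrable (fun x => φ (T x) * w x) m := by
    intro φ hφ
    obtain ⟨C, hC⟩ := hcK.exists_bound_of_continuousOn hφ.continuousOn
    refine hw.bdd_mul (c := C) (hφ.measurable.comp hT).aestronglyMeasurable ?_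
    filter_upwards [hR] with x hx
    exact hC _ (by simpa using hx)
  rw [← norm_le_zero_iff]
  have hb : ∀ ε : ℝ, 0 < ε → ‖∫ x, φ (T x) * w x ∂m‖ ≤ ε * ∫ x, ‖w x‖ ∂m := by
    intro ε hε
    obtain ⟨p, hp⟩ := approx (closedBall (0 : ι → ℂ) R) φ hφ ε hε
    have e : ∫ x, φ (T x) * w x ∂m = ∫ x, (φ (T x) * w x - evp p (T x) * w x) ∂m := by
      rw [integral_sub (hint φ hφ) (hint _ (continuous_evp p)), h p, sub_zero]
    rw [e, ← integral_const_mul]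
    refine norm_integral_le_of_norm_le (hw.norm.const_mul ε) ?_
    filter_upwards [hR] with x hx
    rw [← sub_mul, norm_mul]
    exact mul_le_mul_of_nonneg_right (hp _ (by simpa using hx)) (norm_nonneg _)
  have ht : Tendsto (fun ε : ℝ => ε * ∫ x, ‖w x‖ ∂m) (𝓝[>] 0) (𝓝 0) := by
    have : Tendsto (fun ε : ℝ => ε * ∫ x, ‖w x‖ ∂m) (𝓝 0) (𝓝 (0 * ∫ x, ‖w x‖ ∂m)) :=
      (continuous_id.mul continuous_const).tendsto _
    rw [zero_mul] at this
    exact this.mono_left nhdsWithin_le_nhds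
  exact ge_of_tendsto ht (by filter_upwards [self_mem_nhdsWithin] with ε hε using hb ε hε)

lemma det_one (m : Measure γ) (T : γ → ι → ℂ) (hT : Measurable T) (w : γ → ℂ)
    (hw : Integrable w m) (R : ℝ) (hR : ∀ᵐ x ∂m, ‖T x‖ ≤ R)
    (h : ∀ p : MvPolynomial (ι ⊕ ι) ℂ, ∫ x, evp p (T x) * w x ∂m = 0)
    (B : Set (ι → ℂ)) (hB : MeasurableSet B) : ∫ x in T ⁻¹' B, w x ∂m = 0 := by
  have hc := det_cont m T hT w hw R hR h
  have huniv : ∫ x, w x ∂m = 0 := by simpa using hc (fun _ => 1) continuous_const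
  refine MeasurableSpace.induction_on_inter (C := fun B _ => ∫ x in T ⁻¹' B, w x ∂m = 0)
    (s := {s : Set (ι → ℂ) | IsClosed s}) ?_ isPiSystem_isClosed ?_ ?_ ?_ ?_ B hB
  · rw [← borel_eq_generateFrom_isClosed]; exact BorelSpace.measurable_eq
  · simp
  · intro F hF
    have hF : IsClosed F := hF
    rw [← integral_indicator (hT hF.measurableSet)]
    have hpos : ∀ k : ℕ, (0 : ℝ) < 1 / ((k : ℝ) + 1) := fun k => by positivity
    have ht := tendsto_integral_of_dominated_convergence (μ := m)
      (F := fun k x => ((thickenedIndicator (hpos k) F (T x) : ℝ≥0) : ℂ) * w x)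
      (f := (T ⁻¹' F).indicator w) (fun x => ‖w x‖) ?_ hw.norm ?_ ?_
    · refine tendsto_nhds_unique ht ?_
      have : ∀ k, ∫ x, ((thickenedIndicator (hpos k) F (T x) : ℝ≥0) : ℂ) * w x ∂m = 0 := by
        intro k
        refine hc (fun y => ((thickenedIndicator (hpos k) F y : ℝ≥0) : ℂ)) ?_
        exact Complex.continuous_ofReal.comp
          (NNReal.continuous_coe.comp (thickenedIndicator (hpos k) F).continuous)
      simp only [this]
      exact tendsto_const_nhds
    · intro k
      refine AEStronglyMeasurable.mul ?_ hw.1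
      refine Measurable.aestronglyMeasurable ?_
      exact (Complex.continuous_ofReal.comp
          (NNReal.continuous_coe.comp (thickenedIndicator (hpos k) F).continuous)).measurable.comp hT
    · intro k
      filter_upwards with x
      rw [norm_mul]
      refine mul_le_of_le_one_left (norm_nonneg _) ?_
      rw [Complex.norm_real, NNReal.norm_eq]
      exact_mod_cast thickenedIndicator_le_one (hpos k) F (T x)
    · filter_upwards with x
      have h1 := thickenedIndicator_tendsto_indicator_closure hpos
        tendsto_one_div_add_atTop_nhds_zero_nat F
      rw [hF.closure_eq, tendsto_pi_nhds] at h1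
      have h2 := (Complex.continuous_ofReal.tendsto _).comp
        ((NNReal.continuous_coe.tendsto _).comp (h1 (T x)))
      have h3 := h2.mul_const (w x)
      have h4 : (T ⁻¹' F).indicator w x
          = (((F.indicator (fun _ => (1 : ℝ≥0)) (T x) : ℝ≥0) : ℝ) : ℂ) * w x := by
        by_cases hx : T x ∈ F
        · rw [indicator_of_mem hx, indicator_of_mem (show x ∈ T ⁻¹' F from hx)]; simp
        · rw [indicator_of_notMem hx, indicator_of_notMem (show x ∉ T ⁻¹' F from hx)]; simp
      rw [h4]
      exact h3
  · intro t ht h0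
    have := integral_add_compl (hT ht) hw
    rw [h0, huniv, zero_add] at this
    exact this
  · intro g hd hm h0
    rw [preimage_iUnion]
    have := hasSum_integral_iUnion (f := w) (μ := m) (s := fun i => T ⁻¹' (g i))
      (fun i => hT (hm i)) (fun i j hij => (hd hij).preimage T) hw.integrableOn
    refine this.unique ?_
    simp only [h0]
    exact hasSum_zero

lemma det_two {α β : Type*} [MeasurableSpace α] [MeasurableSpace β] (m : Measure α)
    (m' : Measure β) (T : α → ι → ℂ) (hT : Measurable T) (T' : β → ι → ℂ) (hT' : Measurable T')
    (u : α → ℂ) (hu : Integrable u m) (v : β → ℂ) (hv : Integrable v m') (R : ℝ)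
    (hR : ∀ᵐ x ∂m, ‖T x‖ ≤ R) (hR' : ∀ᵐ x ∂m', ‖T' x‖ ≤ R)
    (h : ∀ p : MvPolynomial (ι ⊕ ι) ℂ,
      ∫ x, evp p (T x) * u x ∂m = ∫ x, evp p (T' x) * v x ∂m')
    (B : Set (ι → ℂ)) (hB : MeasurableSet B) :
    ∫ x in T ⁻¹' B, u x ∂m = ∫ x in T' ⁻¹' B, v x ∂m' := by
  have hbd : ∀ p : MvPolynomial (ι ⊕ ι) ℂ, ∃ C, ∀ x : ι → ℂ, ‖x‖ ≤ R → ‖evp p x‖ ≤ C := by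
    intro p
    obtain ⟨C, hC⟩ := (isCompact_closedBall (0 : ι → ℂ) R).exists_bound_of_continuousOn
      (continuous_evp p).continuousOn
    exact ⟨C, fun x hx => hC x (by simpa using hx)⟩
  have hinl : MeasurableEmbedding (Sum.inl : α → α ⊕ β) :=
    ⟨Sum.inl_injective, measurable_inl, fun _ hs => measurableSet_inl_image.2 hs⟩
  have hinr : MeasurableEmbedding (Sum.inr : β → α ⊕ β) :=
    ⟨Sum.inr_injective, measurable_inr, fun _ hs => measurableSet_inr_image.2 hs⟩
  set M : Measure (α ⊕ β) := m.map Sum.inl + m'.map Sum.inr with hM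
  have hTT : Measurable (Sum.elim T T') := hT.sumElim hT'
  have hw : Integrable (Sum.elim u (fun y => - v y)) M := by
    rw [hM, integrable_add_measure, hinl.integrable_map_iff, hinr.integrable_map_iff]
    exact ⟨hu, hv.neg⟩
  have hwR : ∀ᵐ x ∂M, ‖Sum.elim T T' x‖ ≤ R := by
    rw [hM, ae_add_measure_iff, hinl.ae_map_iff, hinr.ae_map_iff]
    exact ⟨hR, hR'⟩
  have := det_one M (Sum.elim T T') hTT _ hw R hwR ?_ B hB
  · rw [hM, Measure.restrict_add, integral_add_measure, hinl.setIntegral_map,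
      hinr.setIntegral_map] at this
    · simp only [Sum.elim_inl, Sum.elim_inr, integral_neg] at this
      exact sub_eq_zero.1 (by rw [sub_eq_add_neg]; exact this)
    · exact (hw.mono_measure (by rw [hM]; exact Measure.le_add_right le_rfl)).integrableOn
    · exact (hw.mono_measure (by rw [hM]; exact Measure.le_add_left le_rfl)).integrableOn
  · intro p
    obtain ⟨C, hC⟩ := hbd p
    have hi : Integrable (fun x => evp p (Sum.elim T T' x) * Sum.elim u (fun y => - v y) x) M := by
      refine hw.bdd_mul (c := C) ((continuous_evp p).measurable.comp hTT).aestronglyMeasurable ?_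
      filter_upwards [hwR] with x hx using hC _ hx
    rw [hM, integral_add_measure, hinl.integral_map, hinr.integral_map]
    · simp only [Sum.elim_inl, Sum.elim_inr, mul_neg, integral_neg]
      rw [h p, add_neg_cancel]
    · exact (hi.mono_measure (by rw [hM]; exact Measure.le_add_right le_rfl))
    · exact (hi.mono_measure (by rw [hM]; exact Measure.le_add_left le_rfl))

end Det

section NullSet
open MvPolynomial Filter Topology
open scoped Pointwise

variable {m : ℕ}

def qd (j : Fin (m + 1)) (z : EE (m + 1)) : Fin m → ℂ := fun i => z (j.succAbove i) / z j

def Zm {n : ℕ} (z : EE n) : Fin n × Fin n → ℂ := fun p => z p.1 * (starRingEnd ℂ) (z p.2)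

lemma coord_le {n : ℕ} (z : EE n) (i : Fin n) : ‖z i‖ ≤ ‖z‖ := by
  simpa using norm_co_le (Sum.inl i) z

lemma qd_lip (j : Fin (m + 1)) (k : ℕ) :
    LipschitzOnWith (2 * ((k : ℝ≥0) + 1) ^ 2) (qd j)
      {z : EE (m + 1) | ‖z‖ = 1 ∧ 1 / ((k : ℝ) + 1) ≤ ‖z j‖} := by
  refine LipschitzOnWith.of_dist_le_mul ?_
  rintro z ⟨hz, hzj⟩ w ⟨hw, hwj⟩
  have hk : (0 : ℝ) < (k : ℝ) + 1 := by positivity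
  rw [dist_pi_le_iff (by positivity)]
  intro i
  have hzj0 : 0 < ‖z j‖ := lt_of_lt_of_le (by positivity) hzj
  have hwj0 : 0 < ‖w j‖ := lt_of_lt_of_le (by positivity) hwj
  have hz0 : z j ≠ 0 := norm_pos_iff.1 hzj0
  have hw0 : w j ≠ 0 := norm_pos_iff.1 hwj0
  have e : qd j z i - qd j w i
      = ((z (j.succAbove i) - w (j.succAbove i)) * w j - w (j.succAbove i) * (z j - w j))
        * ((z j)⁻¹ * (w j)⁻¹) := by
    simp only [qd]; field_simp; ring
  have h1 : ‖z (j.succAbove i) - w (j.succAbove i)‖ ≤ ‖z - w‖ := by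
    simpa using coord_le (z - w) (j.succAbove i)
  have h2 : ‖z j - w j‖ ≤ ‖z - w‖ := by simpa using coord_le (z - w) j
  have h3 : ‖w j‖ ≤ 1 := hw ▸ coord_le w j
  have h4 : ‖w (j.succAbove i)‖ ≤ 1 := hw ▸ coord_le w _
  have h5 : ‖(z j)⁻¹‖ ≤ k + 1 := by
    rw [norm_inv]; rw [one_div] at hzj
    exact inv_le_of_inv_le₀ hk hzj
  have h6 : ‖(w j)⁻¹‖ ≤ k + 1 := by
    rw [norm_inv]; rw [one_div] at hwj
    exact inv_le_of_inv_le₀ hk hwj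
  have h7 : ‖(z (j.succAbove i) - w (j.succAbove i)) * w j - w (j.succAbove i) * (z j - w j)‖
      ≤ 2 * ‖z - w‖ := by
    refine (norm_sub_le _ _).trans ?_
    rw [norm_mul, norm_mul]
    have a1 : ‖z (j.succAbove i) - w (j.succAbove i)‖ * ‖w j‖ ≤ ‖z - w‖ * 1 := by gcongr
    have a2 : ‖w (j.succAbove i)‖ * ‖z j - w j‖ ≤ 1 * ‖z - w‖ := by gcongr
    linarith
  rw [dist_eq_norm, dist_eq_norm, e, norm_mul, norm_mul]
  push_cast
  calc _ ≤ (2 * ‖z - w‖) * (((k : ℝ) + 1) * (k + 1)) := by gcongr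
    _ = _ := by ring

lemma qd_null (j : Fin (m + 1)) (E : Set (EE (m + 1))) (hEs : E ⊆ unitSphere (m + 1))
    (hE0 : μH[2 * ((m + 1 : ℕ) : ℝ) - 2] E = 0) :
    (volume : Measure (Fin m → ℂ)) (qd j '' (E ∩ {z | z j ≠ 0})) = 0 := by
  have hd : 2 * ((m + 1 : ℕ) : ℝ) - 2 = (Module.finrank ℝ (Fin m → ℂ) : ℝ) := by
    rw [Module.finrank_pi_fintype]; simp; ring
  rw [hd] at hE0
  have hac : (volume : Measure (Fin m → ℂ)) ≪ μH[(Module.finrank ℝ (Fin m → ℂ) : ℝ)] :=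
    Measure.absolutelyContinuous_isAddHaarMeasure _ _
  apply hac
  have hsub : qd j '' (E ∩ {z | z j ≠ 0}) ⊆
      ⋃ k : ℕ, qd j '' (E ∩ {z : EE (m + 1) | ‖z‖ = 1 ∧ 1 / ((k : ℝ) + 1) ≤ ‖z j‖}) := by
    rintro _ ⟨z, ⟨hzE, hzj⟩, rfl⟩
    obtain ⟨k, hk⟩ := exists_nat_one_div_lt (norm_pos_iff.2 hzj)
    refine mem_iUnion.2 ⟨k, z, ⟨hzE, ?_, hk.le⟩, rfl⟩
    simpa [unitSphere] using hEs hzE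
  refine measure_mono_null hsub (measure_iUnion_null fun k => ?_)
  have h := ((qd_lip j k).mono inter_subset_right :
    LipschitzOnWith _ (qd j) (E ∩ _)).hausdorffMeasure_image_le
      (d := (Module.finrank ℝ (Fin m → ℂ) : ℝ)) (by positivity)
  refine le_antisymm (h.trans ?_) bot_le
  rw [measure_mono_null inter_subset_left hE0, mul_zero]

def splitEq (j : Fin (m + 1)) : EE (m + 1) ≃ₗ[ℝ] ℂ × (Fin m → ℂ) where
  toFun z := (z j, fun i => z (j.succAbove i))
  invFun p := WithLp.toLp 2 (j.insertNth (α := fun _ => ℂ) p.1 p.2)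
  map_add' z w := by ext <;> simp
  map_smul' c z := by ext <;> simp
  left_inv z := by
    ext i
    refine Fin.succAboveCases j ?_ (fun i => ?_) i <;> simp
  right_inv p := by ext <;> simp

lemma cone_null (j : Fin (m + 1)) (B : Set (Fin m → ℂ)) (hB : MeasurableSet B)
    (hB0 : volume B = 0) : lam (m + 1) {z | z j ≠ 0 ∧ qd j z ∈ B} = 0 := by
  let Λ := (splitEq j).toContinuousLinearEquiv
  have hac : (lam (m + 1)).map Λ ≪ (volume : Measure ℂ).prod (volume : Measure (Fin m → ℂ)) := by
    have : ((lam (m + 1)).map Λ).IsAddHaarMeasure := Λ.isAddHaarMeasure_map _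
    have : ((volume : Measure ℂ).prod (volume : Measure (Fin m → ℂ))).IsAddHaarMeasure :=
      Measure.prod.instIsAddHaarMeasure _ _
    exact Measure.absolutelyContinuous_isAddHaarMeasure _ _
  let S : Set (ℂ × (Fin m → ℂ)) := {p | p.1 ≠ 0 ∧ (fun i => p.2 i / p.1) ∈ B}
  have hS : MeasurableSet S := by
    refine MeasurableSet.inter ?_ ?_
    · exact (measurableSet_singleton (0 : ℂ)).compl.preimage measurable_fst
    · refine hB.preimage (measurable_pi_lambda _ fun i => ?_)
      exact ((measurable_pi_apply i).comp measurable_snd).div measurable_fst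
  have hS0 : (volume : Measure ℂ).prod (volume : Measure (Fin m → ℂ)) S = 0 := by
    rw [Measure.measure_prod_null hS]
    filter_upwards with t
    have hsub : Prod.mk t ⁻¹' S ⊆
        ((LinearMap.lsmul ℂ (Fin m → ℂ) t).restrictScalars ℝ) '' B := by
      rintro y ⟨ht, hy⟩
      refine ⟨_, hy, ?_⟩
      ext i
      have ht : t ≠ 0 := ht
      simp
      field_simp
    refine measure_mono_null hsub ?_
    rw [Measure.addHaar_image_linearMap, hB0, mul_zero]
  have h := hac hS0
  rw [Measure.map_apply Λ.continuous.measurable hS] at h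
  exact h

lemma continuous_Zm {n : ℕ} : Continuous (Zm : EE n → Fin n × Fin n → ℂ) := by
  refine continuous_pi fun p => ?_
  exact ((co (Sum.inl p.1)).continuous).mul ((co (Sum.inr p.2)).continuous)

lemma exists_null (E : Set (EE (m + 1))) (hEs : E ⊆ unitSphere (m + 1))
    (hE0 : μH[2 * ((m + 1 : ℕ) : ℝ) - 2] E = 0) :
    ∃ B : Set (Fin (m + 1) × Fin (m + 1) → ℂ), MeasurableSet B ∧
      (∀ z ∈ circleOrbit E, Zm z ∈ B) ∧
      sig (m + 1) {s | Zm (s : EE (m + 1)) ∈ B} = 0 := by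
  let C : Fin (m + 1) → Set (Fin m → ℂ) := fun j =>
    toMeasurable volume (qd j '' (E ∩ {z | z j ≠ 0}))
  have hC : ∀ j, MeasurableSet (C j) := fun j => measurableSet_toMeasurable _ _
  have hC0 : ∀ j, volume (C j) = 0 := fun j => by
    rw [measure_toMeasurable]; exact qd_null j E hEs hE0
  let B : Set (Fin (m + 1) × Fin (m + 1) → ℂ) :=
    ⋃ j, {M | M (j, j) ≠ 0 ∧ (fun i => M (j.succAbove i, j) / M (j, j)) ∈ C j}
  have hB : MeasurableSet B := by
    refine MeasurableSet.iUnion fun j => MeasurableSet.inter ?_ ?_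
    · exact (measurableSet_singleton (0 : ℂ)).compl.preimage (measurable_pi_apply (j, j))
    · refine (hC j).preimage (measurable_pi_lambda _ fun i => ?_)
      exact (measurable_pi_apply _).div (measurable_pi_apply _)
  have hZ : ∀ z : EE (m + 1), Zm z ∈ B ↔ ∃ j, z j ≠ 0 ∧ qd j z ∈ C j := by
    intro z
    simp only [B, mem_iUnion, mem_ofPred_eq]
    refine exists_congr fun j => ?_
    have h1 : Zm z (j, j) ≠ 0 ↔ z j ≠ 0 := by simp [Zm]
    rw [h1]
    refine and_congr_right fun h => ?_
    have : (fun i => Zm z (j.succAbove i, j) / Zm z (j, j)) = qd j z := by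
      ext i
      have h' : (starRingEnd ℂ) (z j) ≠ 0 := by simpa using h
      simp only [Zm, qd]
      rw [mul_div_mul_right _ _ h']
    rw [this]
  have hsm : ∀ (c : ℂ) (z : EE (m + 1)), c ≠ 0 → ∀ j, qd j (c • z) = qd j z := by
    intro c z hc j
    ext i
    simp only [qd, PiLp.smul_apply, smul_eq_mul]
    rw [mul_div_mul_left _ _ hc]
  refine ⟨B, hB, ?_, ?_⟩
  · rintro _ ⟨z, hz, t, rfl⟩
    rw [hZ]
    have hz1 : ‖z‖ = 1 := by simpa [unitSphere] using hEs hz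
    have : ∃ j, z j ≠ 0 := by
      by_contra hcon
      push Not at hcon
      have : z = 0 := by ext j; simp [hcon j]
      rw [this] at hz1; simp at hz1
    obtain ⟨j, hj⟩ := this
    refine ⟨j, ?_, ?_⟩
    · simp [hj, Complex.exp_ne_zero]
    · rw [hsm _ _ (Complex.exp_ne_zero _)]
      exact subset_toMeasurable _ _ ⟨z, ⟨hz, hj⟩, rfl⟩
  · have hmeas : MeasurableSet {s : sphere (0 : EE (m + 1)) 1 | Zm (s : EE (m + 1)) ∈ B} :=
      hB.preimage (continuous_Zm.comp continuous_subtype_val).measurable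
    rw [sig, Measure.toSphere_apply' _ hmeas]
    have hsub : Ioo (0 : ℝ) 1 • ((↑) '' {s : sphere (0 : EE (m + 1)) 1 | Zm (s : EE (m + 1)) ∈ B})
        ⊆ ⋃ j, {z : EE (m + 1) | z j ≠ 0 ∧ qd j z ∈ C j} := by
      rintro _ ⟨r, hr, _, ⟨s, hs, rfl⟩, rfl⟩
      obtain ⟨j, hj, hq⟩ := (hZ _).1 hs
      have hr0 : (r : ℂ) ≠ 0 := by exact_mod_cast hr.1.ne'
      have e : r • (s : EE (m + 1)) = (r : ℂ) • (s : EE (m + 1)) := by ext i; simp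
      refine mem_iUnion.2 ⟨j, ?_⟩
      show (r • (s : EE (m + 1))) j ≠ 0 ∧ qd j (r • (s : EE (m + 1))) ∈ C j
      rw [e, hsm _ _ hr0]
      exact ⟨by simp [hr.1.ne', hj], hq⟩
    rw [measure_mono_null hsub (measure_iUnion_null fun j => cone_null j _ (hC j) (hC0 j)),
      mul_zero]

end NullSet

section Assembly
open MvPolynomial Filter Topology

variable {n : ℕ}

def lft (i : (Fin n × Fin n) ⊕ (Fin n × Fin n)) : RR n :=
  Sum.elim (fun p => X (Sum.inl p.1) * X (Sum.inr p.2)) (fun p => X (Sum.inl p.2) * X (Sum.inr p.1)) i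

def pull (p : MvPolynomial ((Fin n × Fin n) ⊕ (Fin n × Fin n)) ℂ) : RR n := bind₁ lft p

lemma biHom_lft (i : (Fin n × Fin n) ⊕ (Fin n × Fin n)) : BiHom 1 1 (lft i) := by
  rcases i with i | i
  · exact (BiHom.X_inl i.1).mul (BiHom.X_inr i.2)
  · exact (BiHom.X_inl i.2).mul (BiHom.X_inr i.1)

lemma ev_pull (p : MvPolynomial ((Fin n × Fin n) ⊕ (Fin n × Fin n)) ℂ) (z : EE n) :
    ev (pull p) z = evp p (Zm z) := by
  induction p using MvPolynomial.induction_on with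
  | C c => simp [pull, evp]
  | add p q hp hq =>
    have : pull (p + q) = pull p + pull q := by simp [pull]
    rw [this, ev_add, hp, hq]; simp [evp]
  | mul_X p i hp =>
    have : pull (p * X i) = pull p * lft i := by simp [pull]
    rw [this, ev_mul, hp]
    rcases i with i | i <;> simp [evp, lft, Zm, mul_comm]

lemma pull_eq {ν : Measure (EE n)} (hsupp : ν (unitSphere n)ᶜ = 0)
    {f : EE n → ℂ} (hf : Integrable f ν) {a b : ℕ} {h : RR n}
    (hh : ∀ (a' b' : ℕ) (P : RR n), BiHom a' b' P → a' + b = b' + a →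
      ∫ z, ev P z * f z ∂ν = ∫ s : sphere (0 : EE n) 1, ev P s * ev h s ∂(sig n))
    (p : MvPolynomial ((Fin n × Fin n) ⊕ (Fin n × Fin n)) ℂ) :
    ∀ (a' b' : ℕ) (g : RR n), BiHom a' b' g → a' + b = b' + a →
      ∫ z, ev (pull p * g) z * f z ∂ν
        = ∫ s : sphere (0 : EE n) 1, ev (pull p * g) s * ev h s ∂(sig n) := by
  induction p using MvPolynomial.induction_on with
  | C c =>
    intro a' b' g hg hab
    have e : pull (C c) * g = c • g := by simp [pull, MvPolynomial.smul_eq_C_mul]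
    rw [e]
    exact hh a' b' _ (hg.smul c) hab
  | add p q hp hq =>
    intro a' b' g hg hab
    have e : pull (p + q) * g = pull p * g + pull q * g := by simp [pull, add_mul]
    rw [e]
    simp only [ev_add, add_mul]
    rw [integral_add (integrable_ev_mul hsupp hf _) (integrable_ev_mul hsupp hf _),
      integral_add
        (sig_integrable (φ := fun z => ev (pull p * g) z * ev h z)
          ((continuous_ev _).mul (continuous_ev h)))
        (sig_integrable (φ := fun z => ev (pull q * g) z * ev h z)
          ((continuous_ev _).mul (continuous_ev h))),
      hp a' b' g hg hab, hq a' b' g hg hab]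
  | mul_X p i hp =>
    intro a' b' g hg hab
    have e : pull (p * X i) * g = pull p * (lft i * g) := by simp [pull, mul_assoc]
    rw [e]
    exact hp _ _ _ ((biHom_lft i).mul hg) (by omega)

lemma norm_Zm_le {z : EE n} (hz : ‖z‖ = 1) : ‖Zm z‖ ≤ 1 := by
  rw [pi_norm_le_iff_of_nonneg zero_le_one]
  intro p
  have h1 : ‖z p.1‖ ≤ 1 := hz ▸ coord_le z _
  have h2 : ‖z p.2‖ ≤ 1 := hz ▸ coord_le z _
  simp only [Zm, norm_mul, RCLike.norm_conj]
  exact mul_le_one₀ h1 (norm_nonneg _) h2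

lemma mono_zero (hn : 0 < n) (d : ℕ) (ν : Measure (EE n)) (hsupp : ν (unitSphere n)ᶜ = 0)
    (f : EE n → ℂ) (hf : Integrable f ν)
    (hdpluri : ∀ p q : ℕ,
      ¬ (((p : ℤ) - d) * ((q : ℤ) - d) = 0 ∧ d ≤ p ∧ d ≤ q) →
      projPQZero ν f p q)
    (B : Set (Fin n × Fin n → ℂ)) (hB : MeasurableSet B)
    (hB0 : sig n {s | Zm (s : EE n) ∈ B} = 0) (a b : ℕ) (g : RR n) (hg : BiHom a b g) :
    ∫ z in Zm ⁻¹' B, ev g z * f z ∂ν = 0 := by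
  obtain ⟨h, hh⟩ := key hn d ν hsupp f hf hdpluri a b
  have := det_two ν (sig n) (Zm : EE n → _) continuous_Zm.measurable
    (fun s : sphere (0 : EE n) 1 => Zm (s : EE n))
    (continuous_Zm.comp continuous_subtype_val).measurable
    (fun z => ev g z * f z) (integrable_ev_mul hsupp hf g)
    (fun s => ev g s * ev h s)
    (sig_integrable (φ := fun z => ev g z * ev h z) ((continuous_ev _).mul (continuous_ev h)))
    1 (by filter_upwards [ae_sphere hsupp] with z hz using norm_Zm_le hz)
    (by filter_upwards with s; exact norm_Zm_le (by simp))
    (by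
      intro p
      have := pull_eq hsupp hf hh p a b g hg (add_comm _ _)
      simpa only [ev_mul, ev_pull, mul_assoc] using this) B hB
  rw [this]
  exact setIntegral_measure_zero _ hB0

lemma all_zero (hn : 0 < n) (d : ℕ) (ν : Measure (EE n)) (hsupp : ν (unitSphere n)ᶜ = 0)
    (f : EE n → ℂ) (hf : Integrable f ν)
    (hdpluri : ∀ p q : ℕ,
      ¬ (((p : ℤ) - d) * ((q : ℤ) - d) = 0 ∧ d ≤ p ∧ d ≤ q) →
      projPQZero ν f p q)
    (B : Set (Fin n × Fin n → ℂ)) (hB : MeasurableSet B)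
    (hB0 : sig n {s | Zm (s : EE n) ∈ B} = 0) :
    f =ᵐ[ν.restrict (Zm ⁻¹' B)] 0 := by
  set F : Set (EE n) := Zm ⁻¹' B with hF
  have hpoly : ∀ g : RR n, ∫ z in F, ev g z * f z ∂ν = 0 := by
    intro g
    rw [g.as_sum]
    simp only [ev_sum, Finset.sum_mul]
    rw [integral_finsetSum _ fun s _ => (integrable_ev_mul hsupp hf _).integrableOn]
    exact Finset.sum_eq_zero fun s _ =>
      mono_zero hn d ν hsupp f hf hdpluri B hB hB0 _ _ _ (BiHom.monomial s _)
  let T : EE n → Fin n → ℂ := fun z i => z i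
  have hT : Continuous T := continuous_pi fun i => (co (Sum.inl i)).continuous
  have hevp : ∀ (p : RR n) (z : EE n), evp p (T z) = ev p z := by
    intro p z
    simp only [evp, ev]
    congr 2
    ext i
    rcases i with i | i <;> rfl
  refine Integrable.ae_eq_zero_of_forall_setIntegral_eq_zero hf.integrableOn fun A hA _ => ?_
  let e : EE n ≃L[ℂ] (Fin n → ℂ) := EuclideanSpace.equiv (Fin n) ℂ
  have := det_one (ν.restrict F) T hT.measurable f hf.integrableOn 1 (by
      filter_upwards [ae_restrict_of_ae (ae_sphere hsupp)] with z hz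
      rw [pi_norm_le_iff_of_nonneg zero_le_one]
      exact fun i => hz ▸ coord_le z i) (by
      intro p
      simp only [hevp]
      exact hpoly p) (e.symm ⁻¹' A) (hA.preimage e.symm.continuous.measurable)
  have e2 : T ⁻¹' (e.symm ⁻¹' A) = A := by
    ext z
    have : e.symm (T z) = z := e.symm_apply_apply z
    simp only [mem_preimage, this]
  rwa [e2] at this

end Assembly

/-- a `d`-pluriharmonic finite complex measure `μ = f·ν` on `S^{2n−1}`
(i.e. `π_{p,q}μ = 0` unless `p,q ≥ d` and `(p−d)(q−d) = 0`) satisfies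
`|μ|(𝕋·E) = 0` whenever `H^{2n−2}(E) = 0`. -/
theorem stmt12 {n : ℕ} (hn : 2 ≤ n) (d : ℕ)
    (ν : Measure (EuclideanSpace ℂ (Fin n))) [IsFiniteMeasure ν]
    (hsupp : ν (unitSphere n)ᶜ = 0)
    (f : EuclideanSpace ℂ (Fin n) → ℂ) (hf : Integrable f ν)
    (hdpluri : ∀ p q : ℕ,
      ¬ (((p : ℤ) - d) * ((q : ℤ) - d) = 0 ∧ d ≤ p ∧ d ≤ q) →
      projPQZero ν f p q)
    (E : Set (EuclideanSpace ℂ (Fin n))) (hEs : E ⊆ unitSphere n)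
    (hE0 : μH[2 * (n : ℝ) - 2] E = 0) :
    ∫ x in circleOrbit E, ‖f x‖ ∂ν = 0 := by
  obtain ⟨m, rfl⟩ : ∃ m, n = m + 1 := ⟨n - 1, by omega⟩
  obtain ⟨B, hB, hsub, hB0⟩ := exists_null E hEs hE0
  have h := all_zero (by omega) d ν hsupp f hf hdpluri B hB hB0
  have h2 : f =ᵐ[ν.restrict (circleOrbit E)] 0 :=
    ae_restrict_of_ae_restrict_of_subset (fun z hz => hsub z hz) h
  refine integral_eq_zero_of_ae ?_
  filter_upwards [h2] with x hx
  simp [hx]
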